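/- If G has a cycle and odw(G) is finite, then there is a cycle C of G and two edge-disjoint paths P, Q of C, both geodesic in G and both of length ⌊odw(G)/2⌋, such that the loaded cycle (C, E(P) ∪ E(Q)) is geodesic in G. -/

import Mathlib

open SimpleGraph

universe u v

/-- A tree-decomposition of `G`: a tree `T` with a bag `B t ⊆ V(G)` for each vertex `t`,
covering all vertices and edges, such that if `t₂` lies on the path of `T` between `t₁`
and `t₃` then `B t₁ ∩ B t₃ ⊆ B t₂`. -/
structure TreeDecomp {V W : Type*} (G : SimpleGraph V) (T : SimpleGraph W) (B : W → Set V) : Prop where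
  isTree : T.IsTree
  coversVertices : ∀ v : V, ∃ t : W, v ∈ B t
  coversEdges : ∀ ⦃u v : V⦄, G.Adj u v → ∃ t : W, u ∈ B t ∧ v ∈ B t
  interpolation : ∀ ⦃t₁ t₂ t₃ : W⦄ (p : T.Walk t₁ t₃), p.IsPath → t₂ ∈ p.support →
    B t₁ ∩ B t₃ ⊆ B t₂

/-- `(C, F)` is a geodesic loaded cycle of `G`: `C` is a cycle, `F` a set of edges of `C`,
and for all vertices `u, v` of `C`, one of the two paths of `C` between `u` and `v`
contains at most `d_G(u,v)` edges of `F`. -/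
def IsGeodesicLoadedCycle {V : Type*} [DecidableEq V] (G : SimpleGraph V) {a : V}
    (C : G.Walk a a) (F : Finset (Sym2 V)) : Prop :=
  C.IsCycle ∧ (∀ e ∈ F, e ∈ C.edges) ∧
    ∀ u v : V, u ∈ C.support → v ∈ C.support →
      ∃ P : G.Walk u v, P.IsPath ∧ (∀ e ∈ P.edges, e ∈ C.edges) ∧
        (F ∩ P.edges.toFinset).card ≤ G.dist u v


section AuxA
variable {V : Type u} {G : SimpleGraph V}

lemma lip_up {z x y : V} (hz : G.Reachable z x) :
    G.dist z y ≤ G.dist z x + G.dist x y := hz.dist_triangle_left y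

lemma desc_split [DecidableEq V] {z u p x : V} (hz : G.Reachable z u) (P : G.Walk u p)
    (hP : P.length + G.dist z p = G.dist z u) (hx : x ∈ P.support) :
    ∃ (A : G.Walk u x) (B : G.Walk x p), A.length + B.length = P.length ∧
      G.dist z x + A.length = G.dist z u ∧ B.length + G.dist z p = G.dist z x ∧
      (∀ e ∈ A.edges, e ∈ P.edges) ∧ (∀ e ∈ B.edges, e ∈ P.edges) ∧
      (∀ y ∈ P.support, y ∈ A.support ∨ y ∈ B.support) := by
  have hs := P.take_spec hx
  have hl : (P.takeUntil x hx).length + (P.dropUntil x hx).length = P.length := by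
    have := congrArg SimpleGraph.Walk.length hs
    rwa [SimpleGraph.Walk.length_append] at this
  refine ⟨P.takeUntil x hx, P.dropUntil x hx, hl, ?_, ?_, ?_, ?_, ?_⟩
  · have h1 := lip_up (y := u) (hz.trans (P.takeUntil x hx).reachable)
    have h2 := lip_up (y := x) (hz.trans P.reachable)
    have h3 := SimpleGraph.dist_le (P.takeUntil x hx)
    have h4 := SimpleGraph.dist_le (P.dropUntil x hx)
    rw [SimpleGraph.dist_comm (u := x) (v := u)] at h1
    rw [SimpleGraph.dist_comm (u := p) (v := x)] at h2
    omega
  · have h1 := lip_up (y := u) (hz.trans (P.takeUntil x hx).reachable)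
    have h2 := lip_up (y := x) (hz.trans P.reachable)
    have h3 := SimpleGraph.dist_le (P.takeUntil x hx)
    have h4 := SimpleGraph.dist_le (P.dropUntil x hx)
    rw [SimpleGraph.dist_comm (u := x) (v := u)] at h1
    rw [SimpleGraph.dist_comm (u := p) (v := x)] at h2
    omega
  · exact fun e he => P.edges_takeUntil_subset_edges hx he
  · exact fun e he => P.edges_dropUntil_subset_edges hx he
  · intro y hy
    rw [← hs, SimpleGraph.Walk.mem_support_append_iff] at hy
    exact hy

lemma geod_pair [DecidableEq V] {z u p x y : V} (hz : G.Reachable z u) (P : G.Walk u p)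
    (hP : P.length + G.dist z p = G.dist z u) (hx : x ∈ P.support) (hy : y ∈ P.support) :
    ∃ W : G.Walk x y, (∀ e ∈ W.edges, e ∈ P.edges) ∧ W.length ≤ G.dist x y := by
  obtain ⟨A, B, h1, h2, h3, h4, h5, h6⟩ := desc_split hz P hP hx
  rcases h6 y hy with h | h
  · obtain ⟨A', B', k1, k2, k3, k4, k5, k6⟩ := desc_split hz A (by omega) h
    refine ⟨B'.reverse, fun e he => h4 e (k5 e (by simpa using he)), ?_⟩
    have := lip_up (y := y) (hz.trans A.reachable)
    simp only [SimpleGraph.Walk.length_reverse]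
    omega
  · obtain ⟨A', B', k1, k2, k3, k4, k5, k6⟩ := desc_split (hz.trans A.reachable) B (by omega) h
    refine ⟨A', fun e he => h5 e (k4 e he), ?_⟩
    have := lip_up (y := x) ((hz.trans A.reachable).trans A'.reachable)
    rw [SimpleGraph.dist_comm (u := y)] at this
    omega

lemma exists_desc {z u : V} (hz : G.Reachable z u) (r : ℕ) (hr : r ≤ G.dist z u) :
    ∃ (p : V) (P : G.Walk u p), P.length = r ∧ P.length + G.dist z p = G.dist z u := by
  obtain ⟨w, hw⟩ := hz.symm.exists_walk_length_eq_dist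
  rw [SimpleGraph.dist_comm (u := u) (v := z)] at hw
  refine ⟨w.getVert r, w.take r, ?_, ?_⟩
  · rw [SimpleGraph.Walk.take_length]; omega
  · have h1 := SimpleGraph.dist_le (w.drop r)
    have h2 := SimpleGraph.dist_le (w.take r)
    rw [SimpleGraph.dist_comm (v := z)] at h1
    have h3 := lip_up (y := u) (hz.trans (w.take r).reachable)
    rw [SimpleGraph.dist_comm (u := w.getVert r) (v := u)] at h3
    rw [SimpleGraph.Walk.take_length] at *
    rw [SimpleGraph.Walk.drop_length] at h1
    omega

def NN [DecidableEq V] (G : SimpleGraph V) (E : List (Sym2 V)) (F : Finset (Sym2 V)) (x y : V) (n : ℕ) : Prop :=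
  ∃ W : G.Walk x y, (∀ e ∈ W.edges, e ∈ E) ∧ (F ∩ W.edges.toFinset).card ≤ n

variable [DecidableEq V] {E : List (Sym2 V)} {F : Finset (Sym2 V)}

lemma NN.of_len {x y : V} (W : G.Walk x y) (h : ∀ e ∈ W.edges, e ∈ E) : NN G E F x y W.length := by
  refine ⟨W, h, ?_⟩
  calc _ ≤ W.edges.toFinset.card := Finset.card_le_card Finset.inter_subset_right
    _ ≤ W.edges.length := List.toFinset_card_le _
    _ = _ := W.length_edges

lemma NN.of_disj {x y : V} (W : G.Walk x y) (h : ∀ e ∈ W.edges, e ∈ E)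
    (h' : ∀ e ∈ W.edges, e ∉ F) : NN G E F x y 0 := by
  refine ⟨W, h, ?_⟩
  simp only [nonpos_iff_eq_zero, Finset.card_eq_zero]
  ext e
  simp only [Finset.mem_inter, List.mem_toFinset, Finset.notMem_empty, iff_false, not_and]
  exact fun h1 h2 => h' e h2 h1

lemma NN.symm {x y : V} {n : ℕ} (h : NN G E F x y n) : NN G E F y x n := by
  obtain ⟨W, h1, h2⟩ := h
  exact ⟨W.reverse, by simpa using h1, by simpa using h2⟩

lemma NN.trans {x y z : V} {n m : ℕ} (h : NN G E F x y n) (h' : NN G E F y z m) :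
    NN G E F x z (n + m) := by
  obtain ⟨W, h1, h2⟩ := h
  obtain ⟨W', h1', h2'⟩ := h'
  refine ⟨W.append W', ?_, ?_⟩
  · intro e he
    rw [SimpleGraph.Walk.edges_append, List.mem_append] at he
    exact he.elim (h1 e) (h1' e)
  · rw [SimpleGraph.Walk.edges_append, List.toFinset_append, Finset.inter_union_distrib_left]
    exact (Finset.card_union_le _ _).trans (by omega)

lemma NN.path {x y : V} {n m : ℕ} (h : NN G E F x y n) (hm : n ≤ m) :
    ∃ P : G.Walk x y, P.IsPath ∧ (∀ e ∈ P.edges, e ∈ E) ∧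
        (F ∩ P.edges.toFinset).card ≤ m := by
  obtain ⟨W, h1, h2⟩ := h
  refine ⟨W.bypass, W.bypass_isPath, fun e he => h1 e (W.edges_bypass_subset_edges he), ?_⟩
  refine (Finset.card_le_card ?_).trans (h2.trans hm)
  apply Finset.inter_subset_inter_left
  intro e he
  simp only [List.mem_toFinset] at he ⊢
  exact W.edges_bypass_subset_edges he

/-- edges are disjoint if the supports share at most one vertex -/
lemma edges_disj {a b c d w : V} (P : G.Walk a b) (Q : G.Walk c d)
    (h : ∀ x ∈ P.support, x ∈ Q.support → x = w) : ∀ e ∈ P.edges, e ∉ Q.edges := by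
  intro e
  induction e with
  | h x y =>
    intro h1 h2
    have e1 := h x (P.fst_mem_support_of_mem_edges h1) (Q.fst_mem_support_of_mem_edges h2)
    have e2 := h y (P.snd_mem_support_of_mem_edges h1) (Q.snd_mem_support_of_mem_edges h2)
    exact (P.adj_of_mem_edges h1).ne (e1.trans e2.symm)

lemma path_append {a b c : V} (P : G.Walk a b) (Q : G.Walk b c) (hP : P.IsPath) (hQ : Q.IsPath)
    (h : ∀ x ∈ P.support, x ∈ Q.support → x = b) : (P.append Q).IsPath := by
  rw [SimpleGraph.Walk.isPath_def, SimpleGraph.Walk.support_append, List.nodup_append']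
  refine ⟨hP.support_nodup, hQ.support_nodup.tail, ?_⟩
  intro x hx hx'
  have hb := h x hx (List.mem_of_mem_tail hx')
  subst hb
  have := hQ.support_nodup
  rw [SimpleGraph.Walk.support_eq_cons, List.nodup_cons] at this
  exact this.1 hx'

lemma cycle_append {a b : V} (P : G.Walk a b) (Q : G.Walk b a) (hP : P.IsPath) (hQ : Q.IsPath)
    (h : ∀ x ∈ P.support, x ∈ Q.support → x = a ∨ x = b) (hl : 1 < P.length ∨ 1 < Q.length) :
    (P.append Q).IsCycle := by
  refine hP.isCycle_append hQ ?_ hl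
  intro x hx hx'
  have h1 := hQ.support_nodup
  rw [SimpleGraph.Walk.support_eq_cons, List.nodup_cons] at h1
  have h2 := hP.support_nodup
  rw [SimpleGraph.Walk.support_eq_cons, List.nodup_cons] at h2
  rcases h x (List.mem_of_mem_tail hx) (List.mem_of_mem_tail hx') with rfl | rfl
  · exact h2.1 hx
  · exact h1.1 hx'

lemma main_cycle (z u v : V) (r : ℕ) (hr : 1 ≤ r) (hz : G.Reachable z u)
    (hvu : G.dist z v ≤ G.dist z u) (huv : G.dist z u ≤ G.dist z v + 1)
    (hd : 2 * r ≤ G.dist u v) (R₀ : G.Walk u v)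
    (hR₀ : ∀ x ∈ R₀.support, x = v ∨ G.dist z u ≤ G.dist z x) :
    ∃ (a : V) (C : G.Walk a a) (u v p q : V) (P : G.Walk u v) (Q : G.Walk p q),
      C.IsCycle ∧ P.IsPath ∧ Q.IsPath ∧
      (∀ e ∈ P.edges, e ∈ C.edges) ∧ (∀ e ∈ Q.edges, e ∈ C.edges) ∧
      (∀ e ∈ P.edges, e ∉ Q.edges) ∧
      P.length = r ∧ Q.length = r ∧
      P.length = G.dist u v ∧ Q.length = G.dist p q ∧
      IsGeodesicLoadedCycle G C (P.edges.toFinset ∪ Q.edges.toFinset) := by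
  have hzv : G.Reachable z v := hz.trans R₀.reachable
  obtain ⟨R, hRp, hR⟩ : ∃ R : G.Walk u v, R.IsPath ∧
      ∀ x ∈ R.support, x = v ∨ G.dist z u ≤ G.dist z x :=
    ⟨R₀.bypass, R₀.bypass_isPath, fun x hx => hR₀ x (R₀.support_bypass_subset_support hx)⟩
  have hdz := hz.symm.dist_triangle_left v
  rw [SimpleGraph.dist_comm (v := z)] at hdz
  obtain ⟨p, P, hPr, hPz⟩ := exists_desc hz r (by omega)
  obtain ⟨q, Q, hQr, hQz⟩ := exists_desc hzv r (by omega)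
  have hzp := hz.trans P.reachable
  have hzq := hzv.trans Q.reachable
  have hPg : P.length = G.dist u p := by
    have := SimpleGraph.dist_le P
    have := lip_up (y := u) hzp
    rw [SimpleGraph.dist_comm (u := p)] at this
    omega
  have hQg : Q.length = G.dist v q := by
    have := SimpleGraph.dist_le Q
    have := lip_up (y := v) hzq
    rw [SimpleGraph.dist_comm (u := q)] at this
    omega
  have hPp := P.isPath_of_length_eq_dist hPg
  have hQp := Q.isPath_of_length_eq_dist hQg
  -- S
  obtain ⟨S, hSp, hS⟩ : ∃ S : G.Walk p q, S.IsPath ∧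
      ∀ x ∈ S.support, x = p ∨ G.dist z x + r ≤ G.dist z v := by
    obtain ⟨p', P', e1, e2⟩ := exists_desc hzp _ le_rfl
    obtain ⟨q', Q', e3, e4⟩ := exists_desc hzq _ le_rfl
    have hp' : z = p' := ((hzp.trans P'.reachable).dist_eq_zero_iff).1 (by omega)
    have hq' : z = q' := ((hzq.trans Q'.reachable).dist_eq_zero_iff).1 (by omega)
    subst hp' hq'
    refine ⟨(P'.append Q'.reverse).bypass, SimpleGraph.Walk.bypass_isPath _, fun x hx => ?_⟩
    have hx := SimpleGraph.Walk.support_bypass_subset_support _ hx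
    rw [SimpleGraph.Walk.mem_support_append_iff] at hx
    rcases hx with hx | hx
    · obtain ⟨A, B, h1, h2, h3, -⟩ := desc_split hzp P' (by omega) hx
      by_cases h0 : A.length = 0
      · left; exact (SimpleGraph.Walk.eq_of_length_eq_zero h0).symm
      · right; omega
    · rw [SimpleGraph.Walk.support_reverse, List.mem_reverse] at hx
      obtain ⟨A, B, h1, h2, h3, -⟩ := desc_split hzq Q' (by omega) hx
      right; omega
  -- distance between P and Q
  have hPx : ∀ x ∈ P.support, G.Reachable z x ∧ ∃ a ≤ r, G.dist z x + a = G.dist z u ∧ G.dist u x ≤ a ∧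
      (a = 0 → x = u) ∧ (a = r → x = p) := by
    intro x hx
    obtain ⟨A, B, h1, h2, h3, -⟩ := desc_split hz P hPz hx
    refine ⟨hz.trans A.reachable, A.length, by omega, by omega, SimpleGraph.dist_le A,
      fun h => (SimpleGraph.Walk.eq_of_length_eq_zero h).symm,
      fun h => SimpleGraph.Walk.eq_of_length_eq_zero (p := B) (by omega)⟩
  have hQx : ∀ x ∈ Q.support, G.Reachable z x ∧ ∃ a ≤ r, G.dist z x + a = G.dist z v ∧ G.dist v x ≤ a ∧
      (a = 0 → x = v) ∧ (a = r → x = q) := by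
    intro x hx
    obtain ⟨A, B, h1, h2, h3, -⟩ := desc_split hzv Q hQz hx
    refine ⟨hzv.trans A.reachable, A.length, by omega, by omega, SimpleGraph.dist_le A,
      fun h => (SimpleGraph.Walk.eq_of_length_eq_zero h).symm,
      fun h => SimpleGraph.Walk.eq_of_length_eq_zero (p := B) (by omega)⟩
  have hfar : ∀ x y, G.Reachable z x → G.Reachable z y →
      2 * r ≤ G.dist u x + G.dist x y + G.dist v y := by
    intro x y hx hy
    have h1 := (hz.symm.trans hx).dist_triangle_left v
    have h2 := (hx.symm.trans hy).dist_triangle_left v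
    rw [SimpleGraph.dist_comm (u := y) (v := v)] at h2
    omega
  have hPQ : ∀ x ∈ P.support, x ∈ Q.support → x = p ∧ x = q := by
    intro x h1 h2
    obtain ⟨k, a, a1, a2, a3, a4, a5⟩ := hPx x h1
    obtain ⟨-, b, b1, b2, b3, b4, b5⟩ := hQx x h2
    have := hfar x x k k
    rw [SimpleGraph.dist_self] at this
    exact ⟨a5 (by omega), b5 (by omega)⟩
  have hPR : ∀ x ∈ P.support, x ∈ R.support → x = u := by
    intro x h1 h2
    obtain ⟨k, a, a1, a2, a3, a4, a5⟩ := hPx x h1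
    rcases hR x h2 with rfl | h
    · exfalso; omega
    · exact a4 (by omega)
  have hQR : ∀ x ∈ Q.support, x ∈ R.support → x = v := by
    intro x h1 h2
    obtain ⟨k, a, a1, a2, a3, a4, a5⟩ := hQx x h1
    rcases hR x h2 with h | h
    · exact h
    · exact a4 (by omega)
  have hPS : ∀ x ∈ P.support, x ∈ S.support → x = p := by
    intro x h1 h2
    obtain ⟨k, a, a1, a2, a3, a4, a5⟩ := hPx x h1
    rcases hS x h2 with h | h
    · exact h
    · exact a5 (by omega)
  have hQS : ∀ x ∈ Q.support, x ∈ S.support → x = q := by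
    intro x h1 h2
    obtain ⟨k, a, a1, a2, a3, a4, a5⟩ := hQx x h1
    rcases hS x h2 with h | h
    · have := hPQ x (h ▸ P.end_mem_support) h1
      exact this.2
    · exact a5 (by omega)
  have hRS : ∀ x ∈ R.support, x ∈ S.support → False := by
    intro x h1 h2
    rcases hS x h2 with h | h
    · have := hPR x (h ▸ P.end_mem_support) h1
      have h0 : G.dist u p = 0 := by rw [← h, this, SimpleGraph.dist_self]
      omega
    · rcases hR x h1 with rfl | h' <;> omega
  have hD1 : (P.append S).IsPath := path_append _ _ hPp hSp hPS
  have hD2 : (Q.reverse.append R.reverse).IsPath := by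
    refine path_append _ _ hQp.reverse hRp.reverse ?_
    simpa using hQR
  have hRl := SimpleGraph.dist_le R
  have hC : ((P.append S).append (Q.reverse.append R.reverse)).IsCycle := by
    refine cycle_append _ _ hD1 hD2 ?_ (by right; simp; omega)
    intro x h1 h2
    rw [SimpleGraph.Walk.mem_support_append_iff] at h1 h2
    simp only [SimpleGraph.Walk.support_reverse, List.mem_reverse] at h2
    rcases h1 with h1 | h1 <;> rcases h2 with h2 | h2
    · exact Or.inr (hPQ x h1 h2).2
    · exact Or.inl (hPR x h1 h2)
    · exact Or.inr (hQS x h2 h1)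
    · exact (hRS x h2 h1).elim
  generalize hCe : ((P.append S).append (Q.reverse.append R.reverse)) = C at hC
  have eP : ∀ e ∈ P.edges, e ∈ C.edges := by
    intro e he; rw [← hCe]; simp [SimpleGraph.Walk.edges_append, he]
  have eQ : ∀ e ∈ Q.edges, e ∈ C.edges := by
    intro e he; rw [← hCe]; simp [SimpleGraph.Walk.edges_append, he]
  have eR : ∀ e ∈ R.edges, e ∈ C.edges := by
    intro e he; rw [← hCe]; simp [SimpleGraph.Walk.edges_append, he]
  have eS : ∀ e ∈ S.edges, e ∈ C.edges := by
    intro e he; rw [← hCe]; simp [SimpleGraph.Walk.edges_append, he]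
  have hCs : ∀ x ∈ C.support, x ∈ P.support ∨ x ∈ Q.support ∨ (x ∈ R.support ∧ x ≠ v) ∨
      (x ∈ S.support ∧ x ≠ p) := by
    intro x hx
    rw [← hCe] at hx
    simp only [SimpleGraph.Walk.mem_support_append_iff, SimpleGraph.Walk.support_reverse,
      List.mem_reverse] at hx
    by_cases h1 : x = v
    · subst h1; exact Or.inr (Or.inl Q.start_mem_support)
    by_cases h2 : x = p
    · subst h2; exact Or.inl P.end_mem_support
    tauto
  refine ⟨u, C, u, p, v, q, P, Q, hC, hPp, hQp, eP, eQ,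
    edges_disj (w := p) P Q (fun x h1 h2 => (hPQ x h1 h2).1), hPr, hQr, hPg, hQg, hC, ?_, ?_⟩
  · intro e he
    simp only [Finset.mem_union, List.mem_toFinset] at he
    exact he.elim (eP e) (eQ e)
  generalize hF : P.edges.toFinset ∪ Q.edges.toFinset = F
  have fR : ∀ e ∈ R.edges, e ∉ F := by
    intro e he hf
    rw [← hF] at hf
    simp only [Finset.mem_union, List.mem_toFinset] at hf
    rcases hf with hf | hf
    · exact edges_disj P R hPR e hf he
    · exact edges_disj Q R hQR e hf he
  have fS : ∀ e ∈ S.edges, e ∉ F := by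
    intro e he hf
    rw [← hF] at hf
    simp only [Finset.mem_union, List.mem_toFinset] at hf
    rcases hf with hf | hf
    · exact edges_disj P S hPS e hf he
    · exact edges_disj Q S hQS e hf he
  have nPx : ∀ x ∈ P.support, G.Reachable z x ∧ ∃ a ≤ r, G.dist z x + a = G.dist z u ∧ G.dist u x ≤ a ∧
      NN G C.edges F u x a ∧ NN G C.edges F x p (r - a) := by
    intro x hx
    obtain ⟨A, B, h1, h2, h3, h4, h5, -⟩ := desc_split hz P hPz hx
    refine ⟨hz.trans A.reachable, A.length, by omega, by omega, SimpleGraph.dist_le A,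
      NN.of_len A (fun e he => eP e (h4 e he)), ?_⟩
    have : r - A.length = B.length := by omega
    rw [this]
    exact NN.of_len B (fun e he => eP e (h5 e he))
  have nQx : ∀ x ∈ Q.support, G.Reachable z x ∧ ∃ a ≤ r, G.dist z x + a = G.dist z v ∧ G.dist v x ≤ a ∧
      NN G C.edges F v x a ∧ NN G C.edges F x q (r - a) := by
    intro x hx
    obtain ⟨A, B, h1, h2, h3, h4, h5, -⟩ := desc_split hzv Q hQz hx
    refine ⟨hzv.trans A.reachable, A.length, by omega, by omega, SimpleGraph.dist_le A,
      NN.of_len A (fun e he => eQ e (h4 e he)), ?_⟩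
    have : r - A.length = B.length := by omega
    rw [this]
    exact NN.of_len B (fun e he => eQ e (h5 e he))
  have nR : NN G C.edges F u v 0 := NN.of_disj R eR fR
  have nS : NN G C.edges F p q 0 := NN.of_disj S eS fS
  have nRx : ∀ x, (x ∈ R.support ∧ x ≠ v) → G.Reachable z x ∧ G.dist z u ≤ G.dist z x ∧
      NN G C.edges F u x 0 := by
    rintro x ⟨hx, hxv⟩
    refine ⟨hz.trans (R.takeUntil x hx).reachable, (hR x hx).resolve_left hxv,
      NN.of_disj (R.takeUntil x hx) (fun e he => eR e (R.edges_takeUntil_subset_edges hx he))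
      (fun e he => fR e (R.edges_takeUntil_subset_edges hx he))⟩
  have nSx : ∀ x, (x ∈ S.support ∧ x ≠ p) → G.Reachable z x ∧ G.dist z x + r ≤ G.dist z v ∧
      NN G C.edges F p x 0 := by
    rintro x ⟨hx, hxv⟩
    refine ⟨hzp.trans (S.takeUntil x hx).reachable, (hS x hx).resolve_left hxv,
      NN.of_disj (S.takeUntil x hx) (fun e he => eS e (S.edges_takeUntil_subset_edges hx he))
      (fun e he => fS e (S.edges_takeUntil_subset_edges hx he))⟩
  suffices H : ∀ x ∈ C.support, ∀ y ∈ C.support, ∃ n ≤ G.dist x y, NN G C.edges F x y n by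
    intro x y hx hy
    obtain ⟨n, h1, h2⟩ := H x hx y hy
    exact h2.path h1
  have sw : ∀ x y, (∃ n ≤ G.dist x y, NN G C.edges F x y n) →
      ∃ n ≤ G.dist y x, NN G C.edges F y x n := by
    rintro x y ⟨n, h1, h2⟩
    exact ⟨n, by rwa [SimpleGraph.dist_comm], h2.symm⟩
  have cPP : ∀ x ∈ P.support, ∀ y ∈ P.support, ∃ n ≤ G.dist x y, NN G C.edges F x y n := by
    intro x hx y hy
    obtain ⟨W, h1, h2⟩ := geod_pair hz P hPz hx hy
    exact ⟨_, h2, NN.of_len W (fun e he => eP e (h1 e he))⟩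
  have cQQ : ∀ x ∈ Q.support, ∀ y ∈ Q.support, ∃ n ≤ G.dist x y, NN G C.edges F x y n := by
    intro x hx y hy
    obtain ⟨W, h1, h2⟩ := geod_pair hzv Q hQz hx hy
    exact ⟨_, h2, NN.of_len W (fun e he => eQ e (h1 e he))⟩
  have cPQ : ∀ x ∈ P.support, ∀ y ∈ Q.support, ∃ n ≤ G.dist x y, NN G C.edges F x y n := by
    intro x hx y hy
    obtain ⟨k, a, a1, a2, a3, a4, a5⟩ := nPx x hx
    obtain ⟨l, b, b1, b2, b3, b4, b5⟩ := nQx y hy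
    refine ⟨_, ?_, (a5.trans nS).trans b5.symm⟩
    have := hfar x y k l
    omega
  have cPR : ∀ x ∈ P.support, ∀ y, (y ∈ R.support ∧ y ≠ v) → ∃ n ≤ G.dist x y, NN G C.edges F x y n := by
    intro x hx y hy
    obtain ⟨k, a, a1, a2, a3, a4, a5⟩ := nPx x hx
    obtain ⟨l, b1, b2⟩ := nRx y hy
    refine ⟨_, ?_, a4.symm.trans b2⟩
    have := lip_up (y := y) k
    omega
  have cQR : ∀ x ∈ Q.support, ∀ y, (y ∈ R.support ∧ y ≠ v) → ∃ n ≤ G.dist x y, NN G C.edges F x y n := by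
    intro x hx y hy
    obtain ⟨k, a, a1, a2, a3, a4, a5⟩ := nQx x hx
    obtain ⟨l, b1, b2⟩ := nRx y hy
    refine ⟨_, ?_, (a4.symm.trans nR.symm).trans b2⟩
    have := lip_up (y := y) k
    omega
  have cPS : ∀ x ∈ P.support, ∀ y, (y ∈ S.support ∧ y ≠ p) → ∃ n ≤ G.dist x y, NN G C.edges F x y n := by
    intro x hx y hy
    obtain ⟨k, a, a1, a2, a3, a4, a5⟩ := nPx x hx
    obtain ⟨l, b1, b2⟩ := nSx y hy
    refine ⟨_, ?_, a5.trans b2⟩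
    have := lip_up (y := x) l
    rw [SimpleGraph.dist_comm (u := y)] at this
    omega
  have cQS : ∀ x ∈ Q.support, ∀ y, (y ∈ S.support ∧ y ≠ p) → ∃ n ≤ G.dist x y, NN G C.edges F x y n := by
    intro x hx y hy
    obtain ⟨k, a, a1, a2, a3, a4, a5⟩ := nQx x hx
    obtain ⟨l, b1, b2⟩ := nSx y hy
    refine ⟨_, ?_, (a5.trans nS.symm).trans b2⟩
    have := lip_up (y := x) l
    rw [SimpleGraph.dist_comm (u := y)] at this
    omega
  have cRS : ∀ x, (x ∈ R.support ∧ x ≠ v) → ∀ y, (y ∈ S.support ∧ y ≠ p) →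
      ∃ n ≤ G.dist x y, NN G C.edges F x y n := by
    intro x hx y hy
    obtain ⟨k, a1, a2⟩ := nRx x hx
    obtain ⟨l, b1, b2⟩ := nSx y hy
    refine ⟨_, ?_, (a2.symm.trans (NN.of_len P eP)).trans b2⟩
    have := lip_up (y := x) l
    rw [SimpleGraph.dist_comm (u := y)] at this
    omega
  intro x hx y hy
  rcases hCs x hx with hx | hx | hx | hx <;> rcases hCs y hy with hy | hy | hy | hy
  · exact cPP x hx y hy
  · exact cPQ x hx y hy
  · exact cPR x hx y hy
  · exact cPS x hx y hy
  · exact sw _ _ (cPQ y hy x hx)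
  · exact cQQ x hx y hy
  · exact cQR x hx y hy
  · exact cQS x hx y hy
  · exact sw _ _ (cPR y hy x hx)
  · exact sw _ _ (cQR y hy x hx)
  · exact ⟨_, by omega, (nRx x hx).2.2.symm.trans (nRx y hy).2.2⟩
  · exact cRS x hx y hy
  · exact sw _ _ (cPS y hy x hx)
  · exact sw _ _ (cQS y hy x hx)
  · exact sw _ _ (cRS y hy x hx)
  · exact ⟨_, by omega, (nSx x hx).2.2.symm.trans (nSx y hy).2.2⟩

end AuxA

section AuxB

def parTree {W : Type u} (par : W → W) (root : W) : SimpleGraph W where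
  Adj a b := (a ≠ root ∧ par a = b ∧ a ≠ b) ∨ (b ≠ root ∧ par b = a ∧ a ≠ b)
  symm := ⟨by
    rintro a b (⟨h1, h2, h3⟩ | ⟨h1, h2, h3⟩)
    · exact Or.inr ⟨h1, h2, h3.symm⟩
    · exact Or.inl ⟨h1, h2, h3.symm⟩⟩
  loopless := ⟨by rintro a (⟨h1, h2, h3⟩ | ⟨h1, h2, h3⟩) <;> exact h3 rfl⟩

lemma parTree_isTree {W : Type u} (par : W → W) (root : W) (depth : W → ℕ)
    (hroot : par root = root) (hdep : ∀ a, a ≠ root → depth (par a) < depth a) :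
    (parTree par root).IsTree := by
  have hadj : ∀ a, a ≠ root → (parTree par root).Adj a (par a) := fun a ha =>
    Or.inl ⟨ha, rfl, fun h => by have := hdep a ha; rw [← h] at this; omega⟩
  have hreach : ∀ n a, depth a ≤ n → (parTree par root).Reachable a root := by
    intro n
    induction n with
    | zero =>
      intro a ha
      by_cases h : a = root
      · rw [h]
      · have := hdep a h; omega
    | succ n ih =>
      intro a ha
      by_cases h : a = root
      · rw [h]
      · have := hdep a h
        exact (hadj a h).reachable.trans (ih _ (by omega))
  have hle : ∀ a, depth (par a) ≤ depth a := by
    intro a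
    by_cases h : a = root
    · rw [h, hroot]
    · exact (hdep a h).le
  have hit : ∀ n a, depth (par^[n] a) ≤ depth a := by
    intro n
    induction n with
    | zero => intro a; simp
    | succ n ih => intro a; rw [Function.iterate_succ_apply]; exact (ih _).trans (hle a)
  have key : ∀ a, a ≠ root → ¬ ((parTree par root).deleteEdges {s(a, par a)}).Reachable a (par a) := by
    rintro a ha ⟨w⟩
    have inv : ∀ {x y : W} (w : ((parTree par root).deleteEdges {s(a, par a)}).Walk x y),
        (∃ n, par^[n] x = a) → ∃ n, par^[n] y = a := by
      intro x y w
      induction w with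
      | nil => exact id
      | @cons x y z h w ih =>
        rintro ⟨n, hn⟩
        apply ih
        rw [SimpleGraph.deleteEdges_adj] at h
        obtain ⟨h, h'⟩ := h
        rcases h with ⟨h1, h2, h3⟩ | ⟨h1, h2, h3⟩
        · cases n with
          | zero =>
            simp only [Function.iterate_zero, id_eq] at hn
            subst hn h2
            exact (h' rfl).elim
          | succ n => exact ⟨n, by rw [← h2, ← Function.iterate_succ_apply]; exact hn⟩
        · exact ⟨n + 1, by rw [Function.iterate_succ_apply, h2]; exact hn⟩
    obtain ⟨n, hn⟩ := inv w ⟨0, rfl⟩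
    have := hit n (par a)
    have := hdep a ha
    rw [hn] at *
    omega
  have : Nonempty W := ⟨root⟩
  refine ⟨⟨fun a b => (hreach _ a le_rfl).trans (hreach _ b le_rfl).symm⟩, ?_⟩
  rw [SimpleGraph.isAcyclic_iff_forall_adj_isBridge]
  rintro a b (⟨h1, rfl, h3⟩ | ⟨h1, rfl, h3⟩)
  · exact SimpleGraph.isBridge_iff.2 (key a h1)
  · rw [Sym2.eq_swap]
    exact SimpleGraph.isBridge_iff.2 (key b h1)

variable {V : Type u} (G : SimpleGraph V)

noncomputable def rt (x : V) : V := (G.connectedComponentMk x).out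

noncomputable def lv (x : V) : ℕ := G.dist (rt G x) x

lemma rt_reach (x : V) : G.Reachable (rt G x) x :=
  SimpleGraph.ConnectedComponent.exact (Quot.out_eq (G.connectedComponentMk x))

lemma rt_eq {x y : V} (h : G.Reachable x y) : rt G x = rt G y := by
  unfold rt
  rw [SimpleGraph.ConnectedComponent.sound h]

lemma lv_adj {x y : V} (h : G.Adj x y) : lv G y ≤ lv G x + 1 := by
  unfold lv
  rw [← rt_eq G h.reachable]
  have := lip_up (y := y) (rt_reach G x)
  rw [SimpleGraph.dist_eq_one_iff_adj.2 h] at this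
  exact this

lemma lv_par (x : V) (h : lv G x ≠ 0) : ∃ y, G.Adj x y ∧ lv G y + 1 = lv G x := by
  obtain ⟨y, P, h1, h2⟩ := exists_desc (rt_reach G x) 1 (by unfold lv at h; omega)
  have ha : G.Adj x y := SimpleGraph.Walk.adj_of_length_eq_one h1
  refine ⟨y, ha, ?_⟩
  unfold lv
  rw [← rt_eq G ha.reachable]
  omega

def lvSetoid : Setoid V where
  r x y := lv G x = lv G y ∧ ∃ p : G.Walk x y, ∀ w ∈ p.support, lv G x ≤ lv G w
  iseqv := ⟨fun x => ⟨rfl, SimpleGraph.Walk.nil, by simp⟩,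
    by
      rintro x y ⟨h, p, hp⟩
      exact ⟨h.symm, p.reverse, by simpa [← h] using hp⟩,
    by
      rintro x y z ⟨h, p, hp⟩ ⟨h', p', hp'⟩
      refine ⟨h.trans h', p.append p', fun w hw => ?_⟩
      rw [SimpleGraph.Walk.mem_support_append_iff] at hw
      rcases hw with hw | hw
      · exact hp w hw
      · rw [h]; exact hp' w hw⟩

abbrev Nd := Quotient (lvSetoid G)

def nd (x : V) : Nd G := Quotient.mk (lvSetoid G) x

lemma nd_eq {x y : V} : nd G x = nd G y ↔
    lv G x = lv G y ∧ ∃ p : G.Walk x y, ∀ w ∈ p.support, lv G x ≤ lv G w := Quotient.eq (r := lvSetoid G)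

lemma nd_out (t : Nd G) : nd G t.out = t := Quotient.out_eq t

open Classical in
noncomputable def ndPar : Option (Nd G) → Option (Nd G)
  | none => none
  | some t => if h : lv G t.out = 0 then none else some (nd G (lv_par G t.out h).choose)

noncomputable def ndDepth : Option (Nd G) → ℕ
  | none => 0
  | some t => lv G t.out + 1

def ndBag : Option (Nd G) → Set V
  | none => ∅
  | some t => {x | nd G x = t ∨ ∃ w, nd G w = t ∧ G.Adj w x ∧ lv G x + 1 = lv G w}

lemma nd_par_eq {x y x' y' : V} (h : nd G x = nd G x') (hx : G.Adj x y) (hx' : G.Adj x' y')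
    (hy : lv G y + 1 = lv G x) (hy' : lv G y' + 1 = lv G x') : nd G y = nd G y' := by
  rw [nd_eq] at h ⊢
  obtain ⟨h1, p, hp⟩ := h
  refine ⟨by omega, SimpleGraph.Walk.cons hx.symm (p.append (SimpleGraph.Walk.cons hx' SimpleGraph.Walk.nil)), ?_⟩
  intro w hw
  simp only [SimpleGraph.Walk.support_cons, List.mem_cons, SimpleGraph.Walk.mem_support_append_iff,
    SimpleGraph.Walk.support_nil, List.not_mem_nil, or_false] at hw
  rcases hw with rfl | hw | rfl | rfl
  · exact le_rfl
  · have := hp w hw; omega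
  · omega
  · omega

lemma ndPar_eq {x y : V} (h : G.Adj x y) (hy : lv G y + 1 = lv G x) :
    ndPar G (some (nd G x)) = some (nd G y) := by
  have h1 := nd_out G (nd G x)
  have h2 := ((nd_eq G).1 h1).1
  have h0 : lv G (nd G x).out ≠ 0 := by omega
  unfold ndPar
  simp only [h0, dite_false, Option.some.injEq]
  have := (lv_par G _ h0).choose_spec
  exact nd_par_eq G h1 this.1 h this.2 hy

lemma nd_isTree : (parTree (ndPar G) none).IsTree := by
  refine parTree_isTree _ _ (ndDepth G) rfl ?_
  rintro (_ | t) ht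
  · exact (ht rfl).elim
  · by_cases h : lv G t.out = 0
    · simp [ndPar, h, ndDepth]
    · have := (lv_par G _ h).choose_spec
      have h1 := ((nd_eq G).1 (nd_out G (nd G (lv_par G _ h).choose))).1
      simp only [ndPar, h, dite_false, ndDepth]
      omega

lemma nd_decomp : TreeDecomp G (parTree (ndPar G) none) (ndBag G) where
  isTree := nd_isTree G
  coversVertices v := ⟨some (nd G v), Or.inl rfl⟩
  coversEdges := by
    intro x y h
    have h1 := lv_adj G h
    have h2 := lv_adj G h.symm
    rcases lt_trichotomy (lv G x) (lv G y) with h3 | h3 | h3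
    · exact ⟨some (nd G y), Or.inr ⟨y, rfl, h.symm, by omega⟩, Or.inl rfl⟩
    · refine ⟨some (nd G x), Or.inl rfl, Or.inl ((nd_eq G).2 ⟨h3.symm, ?_⟩)⟩
      exact ⟨SimpleGraph.Walk.cons h.symm SimpleGraph.Walk.nil, by simp [h3]⟩
    · exact ⟨some (nd G x), Or.inl rfl, Or.inr ⟨x, rfl, h, by omega⟩⟩
  interpolation := by
    classical
    intro t₁ t₂ t₃ p hp ht v hv
    have key : ∀ t, v ∈ ndBag G t → ∃ q : (parTree (ndPar G) none).Walk t (some (nd G v)),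
        ∀ s ∈ q.support, v ∈ ndBag G s := by
      rintro (_ | t) h
      · exact h.elim
      · have h' := h
        rcases h with rfl | ⟨w, rfl, h1, h2⟩
        · exact ⟨SimpleGraph.Walk.nil, by simpa using h'⟩
        · have hpar := ndPar_eq G h1 h2
          have hadj : (parTree (ndPar G) none).Adj (some (nd G w)) (some (nd G v)) := by
            refine Or.inl ⟨by simp, hpar, ?_⟩
            intro h
            have := ((nd_eq G).1 (Option.some.inj h)).1
            omega
          refine ⟨SimpleGraph.Walk.cons hadj SimpleGraph.Walk.nil, ?_⟩
          intro s hs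
          simp only [SimpleGraph.Walk.support_cons, SimpleGraph.Walk.support_nil, List.mem_cons,
            List.not_mem_nil, or_false] at hs
          rcases hs with rfl | rfl
          · exact h'
          · exact Or.inl rfl
    obtain ⟨q1, h1⟩ := key t₁ hv.1
    obtain ⟨q3, h3⟩ := key t₃ hv.2
    have := (nd_isTree G).isAcyclic.path_unique ⟨p, hp⟩ (q1.append q3.reverse).toPath
    have hpe : p = (q1.append q3.reverse).bypass := congrArg Subtype.val this
    rw [hpe] at ht
    have ht := SimpleGraph.Walk.support_bypass_subset_support _ ht
    rw [SimpleGraph.Walk.mem_support_append_iff] at ht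
    rcases ht with ht | ht
    · exact h1 _ ht
    · exact h3 _ (by simpa using ht)

lemma bag_walk {w x : V} (h : x ∈ ndBag G (some (nd G w))) :
    lv G x ≤ lv G w ∧ lv G w ≤ lv G x + 1 ∧ ∃ p : G.Walk x w, ∀ y ∈ p.support, y = x ∨ lv G w ≤ lv G y := by
  rcases h with h | ⟨w', h, h1, h2⟩
  · obtain ⟨h1, p, hp⟩ := (nd_eq G).1 h
    exact ⟨by omega, by omega, p, fun y hy => Or.inr (h1 ▸ hp y hy)⟩
  · obtain ⟨h3, p, hp⟩ := (nd_eq G).1 h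
    refine ⟨by omega, by omega, SimpleGraph.Walk.cons h1.symm p, fun y hy => ?_⟩
    simp only [SimpleGraph.Walk.support_cons, List.mem_cons] at hy
    rcases hy with hy | hy
    · exact Or.inl hy
    · exact Or.inr (h3 ▸ hp y hy)

lemma bag_main [DecidableEq V] (r : ℕ) (hr : 1 ≤ r) {w x y : V}
    (hx : x ∈ ndBag G (some (nd G w))) (hy : y ∈ ndBag G (some (nd G w)))
    (hd : 2 * r ≤ G.dist x y) :
    ∃ (a : V) (C : G.Walk a a) (u v p q : V) (P : G.Walk u v) (Q : G.Walk p q),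
      C.IsCycle ∧ P.IsPath ∧ Q.IsPath ∧
      (∀ e ∈ P.edges, e ∈ C.edges) ∧ (∀ e ∈ Q.edges, e ∈ C.edges) ∧
      (∀ e ∈ P.edges, e ∉ Q.edges) ∧
      P.length = r ∧ Q.length = r ∧
      P.length = G.dist u v ∧ Q.length = G.dist p q ∧
      IsGeodesicLoadedCycle G C (P.edges.toFinset ∪ Q.edges.toFinset) := by
  wlog hle : lv G y ≤ lv G x generalizing x y
  · exact this hy hx (by rwa [SimpleGraph.dist_comm]) (by omega)
  obtain ⟨a1, a2, p, hp⟩ := bag_walk G hx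
  obtain ⟨b1, b2, q, hq⟩ := bag_walk G hy
  have hlv : ∀ s, G.Reachable x s → lv G s = G.dist (rt G x) s := by
    intro s hs
    rw [lv, rt_eq G hs]
  have hxy : G.Reachable x y := (p.append q.reverse).reachable
  refine main_cycle (rt G x) x y r hr (rt_reach G x) ?_ ?_ hd (p.append q.reverse) ?_
  · rw [← hlv y hxy]; exact hle
  · rw [← hlv y hxy]; change lv G x ≤ _; omega
  · intro s hs
    rw [← hlv s ((p.append q.reverse).takeUntil s hs).reachable]
    change _ ∨ lv G x ≤ _
    rw [SimpleGraph.Walk.mem_support_append_iff, SimpleGraph.Walk.support_reverse, List.mem_reverse] at hs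
    rcases hs with hs | hs
    · rcases hp s hs with rfl | h
      · exact Or.inr le_rfl
      · right; omega
    · rcases hq s hs with rfl | h
      · exact Or.inl rfl
      · right; omega

end AuxB

/-- If G has a cycle and odw(G) = k is finite (witnessed by a tree-decomposition of outer
diameter at most k, while every tree-decomposition has two vertices in a common bag at
G-distance at least k), then there is a cycle C of G and two edge-disjoint geodesic paths
P, Q of C, both of length ⌊k/2⌋, such that (C, E(P) ∪ E(Q)) is a geodesic loaded cycle. -/
theorem stmt_8 {V : Type u} [DecidableEq V] (G : SimpleGraph V)
    {W : Type v} (T : SimpleGraph W) (B : W → Set V) (k : ℕ)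
    (hcycle : ∃ (a : V) (C : G.Walk a a), C.IsCycle)
    (hTD : TreeDecomp G T B)
    (houter : ∀ t, ∀ u ∈ B t, ∀ v ∈ B t, G.dist u v ≤ k)
    (hlower : ∀ {W' : Type u} (T' : SimpleGraph W') (B' : W' → Set V), TreeDecomp G T' B' →
      ∃ t : W', ∃ u ∈ B' t, ∃ v ∈ B' t, k ≤ G.dist u v) :
    ∃ (a : V) (C : G.Walk a a) (u v p q : V) (P : G.Walk u v) (Q : G.Walk p q),
      C.IsCycle ∧ P.IsPath ∧ Q.IsPath ∧
      (∀ e ∈ P.edges, e ∈ C.edges) ∧ (∀ e ∈ Q.edges, e ∈ C.edges) ∧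
      (∀ e ∈ P.edges, e ∉ Q.edges) ∧
      P.length = k / 2 ∧ Q.length = k / 2 ∧
      P.length = G.dist u v ∧ Q.length = G.dist p q ∧
      IsGeodesicLoadedCycle G C (P.edges.toFinset ∪ Q.edges.toFinset) := by
  rcases Nat.eq_zero_or_pos (k / 2) with hk | hk
  · obtain ⟨a, C, hC⟩ := hcycle
    refine ⟨a, C, a, a, a, a, SimpleGraph.Walk.nil, SimpleGraph.Walk.nil, hC, ?_⟩
    simp only [hk, IsGeodesicLoadedCycle]
    refine ⟨by simp, by simp, by simp, by simp, by simp, by simp, by simp, by simp, by simp, hC,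
      by simp, fun u v hu hv => ?_⟩
    obtain ⟨W, h1⟩ : ∃ W : G.Walk u v, ∀ e ∈ W.edges, e ∈ C.edges :=
      ⟨(C.takeUntil u hu).reverse.append (C.takeUntil v hv), by
        intro e he
        rw [SimpleGraph.Walk.edges_append, List.mem_append, SimpleGraph.Walk.edges_reverse,
          List.mem_reverse] at he
        exact he.elim (fun h => C.edges_takeUntil_subset_edges hu h)
          (fun h => C.edges_takeUntil_subset_edges hv h)⟩
    exact ⟨W.bypass, W.bypass_isPath, fun e he => h1 e (W.edges_bypass_subset_edges he), by simp⟩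
  · obtain ⟨t, x, hx, y, hy, hd⟩ := hlower _ _ (nd_decomp G)
    rcases t with _ | t
    · exact hx.elim
    · rw [← nd_out G t] at hx hy
      exact bag_main G (k / 2) hk hx hy (by omega)
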